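/- If γ > 4/5 − 10η and P ≠ 0, then 𝔠₁ ≤ C·δ^{−2}·L^{2(d−γ)−(1−γ)−20η}. -/

import Mathlib

open scoped RealInnerProductSpace BigOperators

noncomputable section

/-- The rescaled lattice `ℤ_L^d = (L⁻¹ℤ)^d` inside `ℝ^d`. -/
def ZLat (d : ℕ) (L : ℝ) : Set (EuclideanSpace ℝ (Fin d)) :=
  {x | ∀ i, ∃ m : ℤ, x i = (m : ℝ) / L}

/-- The counting quantity `𝔠₁`. -/
def count1 (d : ℕ) (L δ γ α β : ℝ) (r x0 y0 : EuclideanSpace ℝ (Fin d))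
    (ξ : EuclideanSpace ℝ (Fin d) → EuclideanSpace ℝ (Fin d) → EuclideanSpace ℝ (Fin d)) : ℕ :=
  Set.ncard {p : EuclideanSpace ℝ (Fin d) × EuclideanSpace ℝ (Fin d) |
    p.1 ∈ ZLat d L ∧ p.2 ∈ ZLat d L ∧ ‖p.1 - x0‖ ≤ 1 ∧ ‖p.2 - y0‖ ≤ 1 ∧
    |⟪p.1, p.2⟫ - α| ≤ δ⁻¹ * L ^ (-(2 * γ)) ∧
    |⟪r, ξ p.1 p.2⟫ - β| ≤ δ⁻¹ * L ^ (-(2 * γ))}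

/-- A set is at most as large as any set containing the differences, in the coordinate `g`, of
its points with equal coordinate `f`. -/
theorem ncard_le_of_fiber_sub {σ κ G : Type*} [AddGroup G] {S : Set σ} {T : Set (κ × G)}
    (f : σ → κ) (g : σ → G)
    (hinj : ∀ s ∈ S, ∀ s' ∈ S, f s = f s' → g s = g s' → s = s') (hT : T.Finite)
    (h : ∀ s ∈ S, ∀ s' ∈ S, f s = f s' → (f s, g s - g s') ∈ T) :
    S.Finite ∧ S.ncard ≤ T.ncard := by
  classical
  obtain ⟨b, hb⟩ : ∃ b : κ → G, ∀ s ∈ S, ∃ s' ∈ S, f s' = f s ∧ b (f s) = g s' := by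
    refine ⟨fun c => if hc : ∃ s ∈ S, f s = c then g hc.choose else 0, fun s hs => ?_⟩
    have hc : ∃ s' ∈ S, f s' = f s := ⟨s, hs, rfl⟩
    exact ⟨hc.choose, hc.choose_spec.1, hc.choose_spec.2, by simp only [dif_pos hc]⟩
  have hmaps : Set.MapsTo (fun s => (f s, g s - b (f s))) S T := by
    intro s hs
    obtain ⟨s', hs', hf, hg⟩ := hb s hs
    simpa only [hg] using h s hs s' hs' hf.symm
  have hinjOn : Set.InjOn (fun s => (f s, g s - b (f s))) S := by
    intro s hs s' hs' he
    simp only [Prod.mk.injEq] at he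
    obtain ⟨h1, h2⟩ := he
    rw [h1] at h2
    exact hinj s hs s' hs' h1 (sub_left_injective h2)
  exact ⟨Set.Finite.of_injOn hmaps hinjOn hT,
    Set.ncard_le_ncard_of_injOn _ (fun s hs => hmaps hs) hinjOn hT⟩

/-- The zeros of the split quaternary quadratic form `p u + q v` in a box. -/
def quadZeros (X : ℕ) : Set ((ℤ × ℤ) × (ℤ × ℤ)) :=
  {z | |z.1.1| ≤ X ∧ |z.1.2| ≤ X ∧ |z.2.1| ≤ X ∧ |z.2.2| ≤ X ∧
    z.1.1 * z.2.1 + z.1.2 * z.2.2 = 0}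

theorem exists_factor_of_mul_add_mul_eq_zero {p q u v : ℤ} (hp : p ≠ 0) (h : p * u + q * v = 0) :
    ∃ a b c e : ℤ, 0 < a ∧ b ≠ 0 ∧ p = a * b ∧ q = a * c ∧ v = b * e ∧ u = -(c * e) := by
  have hd : p ∣ q * v := ⟨-u, by linarith⟩
  obtain ⟨a, b, ⟨c, hc⟩, ⟨e, he⟩, hab⟩ := exists_dvd_and_dvd_of_dvd_mul hd
  have ha0 : a ≠ 0 := by rintro rfl; simp at hab; exact hp hab
  have hb0 : b ≠ 0 := by rintro rfl; simp at hab; exact hp hab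
  have hu : u = -(c * e) := by
    have : a * b * (u + c * e) = 0 := by rw [hc, he, hab] at h; linarith
    rcases mul_eq_zero.1 this with h' | h'
    · exact absurd h' (mul_ne_zero ha0 hb0)
    · linarith
  rcases lt_or_gt_of_ne ha0 with ha | ha
  · exact ⟨-a, -b, -c, -e, by omega, by simpa using hb0, by rw [hab]; ring, by rw [hc]; ring,
      by rw [he]; ring, by rw [hu]; ring⟩
  · exact ⟨a, b, c, e, ha, hb0, hab, hc, he, hu⟩

theorem sum_two_mul_div_add_one_le (X : ℕ) :
    ((∑ a ∈ Finset.Icc 1 X, (2 * (X / a) + 1) : ℕ) : ℝ) ≤ 3 * X * (1 + Real.log X) := by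
  have h1 : ((harmonic X : ℚ) : ℝ) ≤ 1 + Real.log X := harmonic_le_one_add_log X
  have h2 : ((harmonic X : ℚ) : ℝ) = ∑ a ∈ Finset.Icc 1 X, (a : ℝ)⁻¹ := by
    rw [harmonic_eq_sum_Icc]; push_cast; rfl
  push_cast
  calc _ ≤ ∑ a ∈ Finset.Icc 1 X, 3 * (X : ℝ) * (a : ℝ)⁻¹ := by
        refine Finset.sum_le_sum fun a ha => ?_
        obtain ⟨ha1, ha2⟩ := Finset.mem_Icc.1 ha
        have hd : (((X / a : ℕ)) : ℝ) ≤ X / a := Nat.cast_div_le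
        have ha' : (1 : ℝ) ≤ X / a := by
          rw [le_div_iff₀ (by positivity)]; simpa using Nat.cast_le (α := ℝ).2 ha2
        rw [mul_assoc, ← div_eq_mul_inv]
        linarith
    _ = 3 * X * ∑ a ∈ Finset.Icc 1 X, (a : ℝ)⁻¹ := by rw [Finset.mul_sum]
    _ ≤ _ := by rw [← h2]; gcongr

open Finset in
/-- A finite set covering `quadZeros X`: three degenerate pieces and the factored solutions. -/
def quadZerosCover (X : ℕ) : Finset ((ℤ × ℤ) × (ℤ × ℤ)) :=
  let I := Icc (-(X : ℤ)) X
  let J := (Icc 1 X).sigma fun a => Icc (-((X / a : ℕ) : ℤ)) ((X / a : ℕ) : ℤ)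
  (((I ×ˢ I).image fun w => ((0, 0), w)) ∪ ((I ×ˢ I).image fun w => (w, (0, 0)))) ∪
    (((I ×ˢ I).image fun w => ((0, w.1), (w.2, 0))) ∪
    ((({1, -1} : Finset ℤ) ×ˢ (J ×ˢ J)).image fun w =>
      (((w.2.1.1 : ℤ) * w.2.1.2, (w.2.1.1 : ℤ) * w.2.2.2),
        (-(w.2.2.2 * (w.1 * (w.2.2.1 : ℤ))), w.2.1.2 * (w.1 * (w.2.2.1 : ℤ))))))

theorem abs_le_div_of_abs_mul_le {X a : ℕ} {b : ℤ} (ha : 0 < a) (h : |(a : ℤ) * b| ≤ X) :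
    b ∈ Finset.Icc (-((X / a : ℕ) : ℤ)) ((X / a : ℕ) : ℤ) := by
  rw [Finset.mem_Icc, ← abs_le, Int.natCast_div, Int.le_ediv_iff_mul_le (by exact_mod_cast ha)]
  rwa [abs_mul, Nat.abs_cast, mul_comm] at h

theorem quadZeros_subset (X : ℕ) : quadZeros X ⊆ quadZerosCover X := by
  rintro ⟨⟨p, q⟩, ⟨u, v⟩⟩ ⟨hp, hq, hu, hv, h⟩
  simp only at hp hq hu hv h
  have mI : ∀ {t : ℤ}, |t| ≤ X → t ∈ Finset.Icc (-(X : ℤ)) X := fun ht =>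
    Finset.mem_Icc.2 (abs_le.1 ht)
  simp only [quadZerosCover, Finset.coe_union, Set.mem_union, Finset.mem_coe, Finset.mem_image,
    Finset.mem_product]
  by_cases hp0 : p = 0
  · subst hp0
    rw [zero_mul, zero_add, mul_eq_zero] at h
    rcases h with rfl | rfl
    · exact Or.inl (Or.inl ⟨(u, v), ⟨mI hu, mI hv⟩, rfl⟩)
    · exact Or.inr (Or.inl ⟨(q, u), ⟨mI hq, mI hu⟩, rfl⟩)
  obtain ⟨a, b, c, e, ha, hb, rfl, rfl, rfl, rfl⟩ := exists_factor_of_mul_add_mul_eq_zero hp0 h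
  by_cases he : e = 0
  · subst he
    exact Or.inl (Or.inr ⟨(a * b, a * c), ⟨mI hp, mI hq⟩, by simp⟩)
  refine Or.inr (Or.inr ⟨(e.sign, ⟨a.natAbs, b⟩, ⟨e.natAbs, c⟩), ⟨?_, ?_, ?_⟩, ?_⟩)
  · rcases lt_or_gt_of_ne he with h' | h'
    · simp [Int.sign_eq_neg_one_of_neg h']
    · simp [Int.sign_eq_one_of_pos h']
  · have ha1 : 0 < a.natAbs := by omega
    have ha2 : ((a.natAbs : ℕ) : ℤ) = a := by omega
    have hle : |a| ≤ X := by
      refine le_trans ?_ hp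
      rw [abs_mul]
      exact le_mul_of_one_le_right (abs_nonneg a) (Int.one_le_abs hb)
    exact Finset.mem_sigma.2 ⟨Finset.mem_Icc.2 ⟨ha1, by
      rw [abs_of_pos ha] at hle; simp only; omega⟩,
      abs_le_div_of_abs_mul_le ha1 (by simpa [abs_of_pos ha] using hp)⟩
  · have he1 : 0 < e.natAbs := by omega
    have hle : |e| ≤ X := by
      refine le_trans ?_ hv
      rw [abs_mul]
      exact le_mul_of_one_le_left (abs_nonneg e) (Int.one_le_abs hb)
    refine Finset.mem_sigma.2 ⟨Finset.mem_Icc.2 ⟨he1, by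
      rw [Int.abs_eq_natAbs] at hle; simp only; omega⟩, abs_le_div_of_abs_mul_le he1 ?_⟩
    rw [abs_neg, abs_mul] at hu
    rw [abs_mul, Nat.abs_cast, Int.natCast_natAbs, mul_comm]
    exact hu
  · have ha2 : ((a.natAbs : ℕ) : ℤ) = a := by omega
    simp only [ha2, Int.sign_mul_natAbs]

theorem card_quadZerosCover_le {X : ℕ} (hX : 1 ≤ X) :
    ((quadZerosCover X).card : ℝ) ≤ 45 * (X * (1 + Real.log X)) ^ 2 := by
  set I := Finset.Icc (-(X : ℤ)) X with hI
  set J := (Finset.Icc 1 X).sigma fun a => Finset.Icc (-((X / a : ℕ) : ℤ)) ((X / a : ℕ) : ℤ) with hJ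
  have hIc : I.card = 2 * X + 1 := by rw [hI, Int.card_Icc]; omega
  have hJc : J.card = ∑ a ∈ Finset.Icc 1 X, (2 * (X / a) + 1) := by
    rw [hJ, Finset.card_sigma]
    refine Finset.sum_congr rfl fun a _ => ?_
    rw [Int.card_Icc]; omega
  have hc : (quadZerosCover X).card ≤
      (I.card * I.card + I.card * I.card) + (I.card * I.card + 2 * (J.card * J.card)) := by
    refine (Finset.card_union_le _ _).trans (add_le_add
      ((Finset.card_union_le _ _).trans (add_le_add ?_ ?_))
      ((Finset.card_union_le _ _).trans (add_le_add ?_ ?_))) <;>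
    refine Finset.card_image_le.trans ?_
    · rw [Finset.card_product]
    · rw [Finset.card_product]
    · rw [Finset.card_product]
    · rw [Finset.card_product, Finset.card_product, Finset.card_pair (by norm_num)]
  have hJr : (J.card : ℝ) ≤ 3 * X * (1 + Real.log X) := by
    rw [hJc]; exact sum_two_mul_div_add_one_le X
  have hX' : (1 : ℝ) ≤ X := by exact_mod_cast hX
  have hlog : 0 ≤ Real.log X := Real.log_nonneg hX'
  have hIr : (I.card : ℝ) ≤ 3 * X * (1 + Real.log X) := by
    rw [hIc]; push_cast; nlinarith
  have hc' : ((quadZerosCover X).card : ℝ) ≤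
      3 * (I.card : ℝ) ^ 2 + 2 * (J.card : ℝ) ^ 2 := by
    have : ((quadZerosCover X).card : ℝ) ≤ ((I.card * I.card + I.card * I.card) +
      (I.card * I.card + 2 * (J.card * J.card)) : ℕ) := by exact_mod_cast hc
    push_cast at this
    linarith
  have h1 : (I.card : ℝ) ^ 2 ≤ (3 * X * (1 + Real.log X)) ^ 2 := by gcongr
  have h2 : (J.card : ℝ) ^ 2 ≤ (3 * X * (1 + Real.log X)) ^ 2 := by gcongr
  nlinarith

theorem quadZeros_finite (X : ℕ) : (quadZeros X).Finite :=
  (quadZerosCover X).finite_toSet.subset (quadZeros_subset X)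

theorem ncard_quadZeros_le {X : ℕ} (hX : 1 ≤ X) :
    ((quadZeros X).ncard : ℝ) ≤ 45 * (X * (1 + Real.log X)) ^ 2 := by
  refine le_trans ?_ (card_quadZerosCover_le hX)
  rw [← Set.ncard_coe_finset]
  exact_mod_cast Set.ncard_le_ncard (quadZeros_subset X) (quadZerosCover X).finite_toSet

/-- Near-zeros of the split quaternary quadratic form `p u + q v` in a box. -/
def quadNearZeros (X h : ℕ) : Set ((ℤ × ℤ) × (ℤ × ℤ)) :=
  {z | |z.1.1| ≤ X ∧ |z.1.2| ≤ X ∧ |z.2.1| ≤ X ∧ |z.2.2| ≤ X ∧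
    |z.1.1 * z.2.1 + z.1.2 * z.2.2| ≤ h}

theorem ncard_quadNearZeros_le (X h : ℕ) :
    (quadNearZeros X h).Finite ∧
      (quadNearZeros X h).ncard ≤ (2 * h + 1) * (quadZeros (2 * X)).ncard := by
  let T : Set ((ℤ × (ℤ × ℤ)) × (ℤ × ℤ)) :=
    {z | |z.1.1| ≤ h ∧ (z.1.2, z.2) ∈ quadZeros (2 * X)}
  let U : Set (ℤ × ((ℤ × ℤ) × (ℤ × ℤ))) := ((Finset.Icc (-(h : ℤ)) h : Finset ℤ) : Set ℤ) ×ˢ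
    quadZeros (2 * X)
  have hU : U.Finite := (Finset.finite_toSet _).prod (quadZeros_finite _)
  have hm : Set.MapsTo (fun z : (ℤ × (ℤ × ℤ)) × (ℤ × ℤ) => (z.1.1, (z.1.2, z.2))) T U := by
    rintro z ⟨h1, h2⟩
    exact ⟨Finset.mem_coe.2 (Finset.mem_Icc.2 (abs_le.1 h1)), h2⟩
  have hi : Set.InjOn (fun z : (ℤ × (ℤ × ℤ)) × (ℤ × ℤ) => (z.1.1, (z.1.2, z.2))) T := by
    rintro ⟨⟨a, b⟩, c⟩ _ ⟨⟨a', b'⟩, c'⟩ _ he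
    simp only [Prod.mk.injEq] at he ⊢
    tauto
  have hT : T.Finite := Set.Finite.of_injOn hm hi hU
  have hTc : T.ncard ≤ (2 * h + 1) * (quadZeros (2 * X)).ncard := by
    refine (Set.ncard_le_ncard_of_injOn _ (fun z hz => hm hz) hi hU).trans ?_
    rw [Set.ncard_prod, Set.ncard_coe_finset, Int.card_Icc]
    exact Nat.mul_le_mul_right _ (by omega)
  have key := ncard_le_of_fiber_sub (S := quadNearZeros X h) (T := T)
    (fun z => (z.1.1 * z.2.1 + z.1.2 * z.2.2, z.1)) (fun z => z.2) ?_ hT ?_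
  · exact ⟨key.1, key.2.trans hTc⟩
  · rintro ⟨a, b⟩ _ ⟨a', b'⟩ _ he hb
    simp only [Prod.mk.injEq] at he hb ⊢
    exact ⟨he.2, hb⟩
  · rintro ⟨⟨p, q⟩, ⟨u, v⟩⟩ ⟨h1, h2, h3, h4, h5⟩ ⟨⟨p', q'⟩, ⟨u', v'⟩⟩ ⟨h1', h2', h3', h4', h5'⟩ he
    simp only [Prod.mk.injEq] at *
    obtain ⟨he, rfl, rfl⟩ := he
    refine ⟨h5, ?_, ?_, ?_, ?_, ?_⟩ <;> simp only [Prod.fst_sub, Prod.snd_sub] <;> push_cast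
    · linarith [abs_nonneg p]
    · linarith [abs_nonneg q]
    · rw [abs_le] at *; constructor <;> linarith
    · rw [abs_le] at *; constructor <;> linarith
    · linarith

open Finset in
/-- Integer vectors in a box that vanish on the coordinates in `s`. -/
def boxOff {d : ℕ} (R : ℕ) (s : Finset (Fin d)) : Finset (Fin d → ℤ) :=
  Fintype.piFinset fun a => if a ∈ s then {0} else Icc (-(R : ℤ)) R

theorem card_boxOff {d : ℕ} (R : ℕ) (s : Finset (Fin d)) :
    (boxOff R s).card = (2 * R + 1) ^ (d - s.card) := by
  have : ∀ a : Fin d, (if a ∈ s then ({0} : Finset ℤ) else Finset.Icc (-(R : ℤ)) R).card =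
      if a ∈ sᶜ then 2 * R + 1 else 1 := by
    intro a
    by_cases h : a ∈ s
    · simp [h]
    · simp only [h, Finset.mem_compl, not_false_eq_true, if_true, if_false, Int.card_Icc]; omega
  rw [boxOff, Fintype.card_piFinset, Finset.prod_congr rfl fun a _ => this a,
    Finset.prod_ite_mem, Finset.univ_inter, Finset.prod_const, Finset.card_compl, Fintype.card_fin]

/-- Set the coordinates in `s` to zero. -/
def killOn {d : ℕ} (s : Finset (Fin d)) (m : Fin d → ℤ) : Fin d → ℤ :=
  fun a => if a ∈ s then 0 else m a

theorem killOn_mem_boxOff {d R : ℕ} {s : Finset (Fin d)} {m : Fin d → ℤ}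
    (hm : ∀ a, |m a| ≤ R) : killOn s m ∈ boxOff R s := by
  rw [boxOff, Fintype.mem_piFinset]
  intro a
  by_cases h : a ∈ s
  · simp [killOn, h]
  · simpa [killOn, h] using abs_le.1 (hm a)

theorem eq_of_killOn_eq {d : ℕ} {s : Finset (Fin d)} {m m' : Fin d → ℤ}
    (h : killOn s m = killOn s m') {a : Fin d} (ha : a ∉ s) : m a = m' a := by
  simpa [killOn, ha] using congrFun h a

theorem sum_mul_sub_sum_mul {d : ℕ} {s : Finset (Fin d)} {m m' : Fin d → ℤ}
    (h : killOn s m = killOn s m') (w : Fin d → ℤ) :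
    ∑ a, w a * m a - ∑ a, w a * m' a = ∑ a ∈ s, w a * (m a - m' a) := by
  rw [← Finset.sum_sub_distrib]
  symm
  refine (Finset.sum_subset (Finset.subset_univ s) fun a _ ha => ?_).trans
    (Finset.sum_congr rfl fun a _ => by ring)
  rw [eq_of_killOn_eq h ha, sub_self, mul_zero]

/-- Pairs of almost orthogonal integer vectors in a box, the first almost orthogonal to `k`. -/
def nearOrth {d : ℕ} (R h : ℕ) (k : Fin d → ℤ) : Set ((Fin d → ℤ) × (Fin d → ℤ)) :=
  {z | (∀ a, |z.1 a| ≤ R) ∧ (∀ a, |z.2 a| ≤ R) ∧ |∑ a, z.1 a * z.2 a| ≤ 4 * h ∧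
    |∑ a, k a * z.1 a| ≤ 2 * h}

theorem ncard_nearOrth_le {d : ℕ} (R h : ℕ) {k : Fin d → ℤ} {i j l : Fin d} (hi : k i ≠ 0)
    (hji : j ≠ i) (hli : l ≠ i) (hjl : j ≠ l) :
    (nearOrth R h k).Finite ∧ (nearOrth R h k).ncard ≤
      (2 * R + 1) ^ (d - 3) * ((2 * R + 1) ^ (d - 2) *
        ((8 * h + 1) * (quadNearZeros (2 * R) (8 * h)).ncard)) := by
  let V := Fin d → ℤ
  let s3 : Finset (Fin d) := {i, j, l}
  let s2 : Finset (Fin d) := {j, l}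
  have hs3 : s3.card = 3 := Finset.card_eq_three.2 ⟨i, j, l, hji.symm, hli.symm, hjl, rfl⟩
  have hs2 : s2.card = 2 := Finset.card_pair hjl
  let U : Set (V × (V × (ℤ × ((ℤ × ℤ) × (ℤ × ℤ))))) :=
    (boxOff R s3 : Set V) ×ˢ ((boxOff R s2 : Set V) ×ˢ
      (((Finset.Icc (-((4 * h : ℕ) : ℤ)) ((4 * h : ℕ) : ℤ) : Finset ℤ) : Set ℤ) ×ˢ
        quadNearZeros (2 * R) (8 * h)))
  have hUf : U.Finite := (Finset.finite_toSet _).prod ((Finset.finite_toSet _).prod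
    ((Finset.finite_toSet _).prod (ncard_quadNearZeros_le _ _).1))
  have hUc : U.ncard = (2 * R + 1) ^ (d - 3) * ((2 * R + 1) ^ (d - 2) *
        ((8 * h + 1) * (quadNearZeros (2 * R) (8 * h)).ncard)) := by
    have hc3 : (boxOff R s3 : Set V).ncard = (2 * R + 1) ^ (d - 3) :=
      (Set.ncard_coe_finset _).trans (by rw [card_boxOff, hs3])
    have hc2 : (boxOff R s2 : Set V).ncard = (2 * R + 1) ^ (d - 2) :=
      (Set.ncard_coe_finset _).trans (by rw [card_boxOff, hs2])
    rw [Set.ncard_prod, Set.ncard_prod, Set.ncard_prod, hc3, hc2, Set.ncard_coe_finset,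
      Int.card_Icc]
    congr 3
    omega
  let T₂ : Set ((V × V × (ℤ × ℤ)) × ℤ) :=
    {z | (∀ a, |z.1.1 a| ≤ R) ∧ z.1.2.1 ∈ boxOff R s2 ∧ z.1.1 i = 0 ∧ |z.2| ≤ (4 * h : ℕ) ∧
      ((z.1.1 j, z.1.1 l), z.1.2.2) ∈ quadNearZeros (2 * R) (8 * h)}
  let φ : (V × V × (ℤ × ℤ)) × ℤ → V × (V × (ℤ × ((ℤ × ℤ) × (ℤ × ℤ)))) :=
    fun z => (killOn s3 z.1.1, z.1.2.1, z.2, ((z.1.1 j, z.1.1 l), z.1.2.2))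
  have hφm : Set.MapsTo φ T₂ U := by
    rintro z ⟨h1, h2, -, h3, h4⟩
    exact ⟨killOn_mem_boxOff h1, h2, Finset.mem_coe.2 (Finset.mem_Icc.2 (abs_le.1 h3)), h4⟩
  have hφi : Set.InjOn φ T₂ := by
    rintro ⟨⟨m, n, w⟩, t⟩ ⟨-, -, h0, -, -⟩ ⟨⟨m', n', w'⟩, t'⟩ ⟨-, -, h0', -, -⟩ he
    simp only [φ, Prod.mk.injEq] at he h0 h0' ⊢
    obtain ⟨e1, e2, e3, ⟨e4, e5⟩, e6⟩ := he
    refine ⟨⟨funext fun a => ?_, e2, e6⟩, e3⟩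
    by_cases ha : a ∈ s3
    · simp only [s3, Finset.mem_insert, Finset.mem_singleton] at ha
      rcases ha with rfl | rfl | rfl
      · rw [h0, h0']
      · exact e4
      · exact e5
    · exact eq_of_killOn_eq e1 ha
  have hT₂f : T₂.Finite := Set.Finite.of_injOn hφm hφi hUf
  have hT₂c : T₂.ncard ≤ U.ncard := Set.ncard_le_ncard_of_injOn _ (fun z hz => hφm hz) hφi hUf
  let T₁ : Set ((V × V) × (ℤ × ℤ)) :=
    {z | (∀ a, |z.1.1 a| ≤ R) ∧ z.1.2 ∈ boxOff R s2 ∧ |∑ a, k a * z.1.1 a| ≤ 2 * h ∧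
      ((z.1.1 j, z.1.1 l), z.2) ∈ quadNearZeros (2 * R) (8 * h)}
  have key₁ := ncard_le_of_fiber_sub (S := T₁) (T := T₂)
    (fun z => (killOn {i} z.1.1, z.1.2, z.2)) (fun z => z.1.1 i) ?_ hT₂f ?_
  · have key₀ := ncard_le_of_fiber_sub (S := nearOrth R h k) (T := T₁)
      (fun z => (z.1, killOn s2 z.2)) (fun z => (z.2 j, z.2 l)) ?_ key₁.1 ?_
    · exact ⟨key₀.1, (key₀.2.trans (key₁.2.trans hT₂c)).trans hUc.le⟩
    · rintro ⟨m, n⟩ - ⟨m', n'⟩ - he hb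
      simp only [Prod.mk.injEq] at he hb ⊢
      refine ⟨he.1, funext fun a => ?_⟩
      by_cases ha : a ∈ s2
      · simp only [s2, Finset.mem_insert, Finset.mem_singleton] at ha
        rcases ha with rfl | rfl
        · exact hb.1
        · exact hb.2
      · exact eq_of_killOn_eq he.2 ha
    · rintro ⟨m, n⟩ ⟨h1, h2, h3, h4⟩ ⟨m', n'⟩ ⟨h1', h2', h3', h4'⟩ he
      simp only [Prod.mk.injEq] at he h1 h2 h3 h4 h1' h2' h3' h4'
      obtain ⟨rfl, he⟩ := he
      have hs := sum_mul_sub_sum_mul he m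
      simp only [s2, Finset.sum_pair hjl] at hs
      refine ⟨h1, killOn_mem_boxOff h2, h4, ?_, ?_, ?_, ?_, ?_⟩ <;>
        simp only [Prod.fst_sub, Prod.snd_sub] <;> push_cast
      · linarith [h1 j, abs_nonneg (m j)]
      · linarith [h1 l, abs_nonneg (m l)]
      · have := h2 j; have := h2' j; rw [abs_le] at *; constructor <;> linarith
      · have := h2 l; have := h2' l; rw [abs_le] at *; constructor <;> linarith
      · rw [← hs]; rw [abs_le] at *; constructor <;> linarith
  · rintro ⟨⟨m, n⟩, w⟩ - ⟨⟨m', n'⟩, w'⟩ - he hb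
    simp only [Prod.mk.injEq] at he hb ⊢
    refine ⟨⟨funext fun a => ?_, he.2.1⟩, he.2.2⟩
    by_cases ha : a = i
    · rw [ha, hb]
    · exact eq_of_killOn_eq he.1 (by simpa using ha)
  · rintro ⟨⟨m, n⟩, w⟩ ⟨h1, h2, h3, h4⟩ ⟨⟨m', n'⟩, w'⟩ ⟨h1', h2', h3', h4'⟩ he
    simp only [Prod.mk.injEq] at he h1 h2 h3 h4 h1' h2' h3' h4'
    obtain ⟨he, rfl, rfl⟩ := he
    have hs := sum_mul_sub_sum_mul he k
    rw [Finset.sum_singleton] at hs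
    refine ⟨fun a => ?_, h2, ?_, ?_, ?_⟩
    · by_cases ha : a = i
      · simp [killOn, ha]
      · simpa [killOn, ha] using h1 a
    · simp [killOn]
    · have h5 : |m i - m' i| ≤ |k i * (m i - m' i)| := by
        rw [abs_mul]; exact le_mul_of_one_le_left (abs_nonneg _) (Int.one_le_abs hi)
      refine h5.trans ?_
      rw [← hs]; push_cast; rw [abs_le] at h3 h3' ⊢; constructor <;> linarith
    · simpa [killOn, hji, hli] using h4

theorem sub_mem_ZLat {d : ℕ} {L : ℝ} {x y : EuclideanSpace ℝ (Fin d)} (hx : x ∈ ZLat d L)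
    (hy : y ∈ ZLat d L) : x - y ∈ ZLat d L := by
  intro a
  obtain ⟨m, hm⟩ := hx a
  obtain ⟨n, hn⟩ := hy a
  exact ⟨m - n, by rw [PiLp.sub_apply, hm, hn]; push_cast; ring⟩

/-- The integer vector `L x`, for `x` in the rescaled lattice. -/
def latInt {d : ℕ} (L : ℝ) (x : EuclideanSpace ℝ (Fin d)) : Fin d → ℤ := fun a => ⌊L * x a⌋

theorem latInt_cast {d : ℕ} {L : ℝ} (hL : 0 < L) {x : EuclideanSpace ℝ (Fin d)}
    (hx : x ∈ ZLat d L) (a : Fin d) : (latInt L x a : ℝ) = L * x a := by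
  obtain ⟨m, hm⟩ := hx a
  have : L * x a = m := by rw [hm]; field_simp
  rw [latInt, this, Int.floor_intCast]

theorem sum_latInt {d : ℕ} {L : ℝ} (hL : 0 < L) {x y : EuclideanSpace ℝ (Fin d)}
    (hx : x ∈ ZLat d L) (hy : y ∈ ZLat d L) :
    ((∑ a, latInt L x a * latInt L y a : ℤ) : ℝ) = L ^ 2 * ⟪x, y⟫ := by
  push_cast
  rw [PiLp.inner_apply, Finset.mul_sum]
  refine Finset.sum_congr rfl fun a _ => ?_
  rw [latInt_cast hL hx, latInt_cast hL hy, Real.inner_apply]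
  ring

theorem latInt_injOn {d : ℕ} {L : ℝ} (hL : 0 < L) {x y : EuclideanSpace ℝ (Fin d)}
    (hx : x ∈ ZLat d L) (hy : y ∈ ZLat d L) (h : latInt L x = latInt L y) : x = y := by
  ext a
  have := congrFun h a
  have h' : (latInt L x a : ℝ) = latInt L y a := by rw [this]
  rw [latInt_cast hL hx, latInt_cast hL hy] at h'
  exact mul_left_cancel₀ hL.ne' h'

theorem abs_latInt_le {d R : ℕ} {L : ℝ} (hL : 0 < L) {x : EuclideanSpace ℝ (Fin d)}
    (hx : x ∈ ZLat d L) (hn : ‖x‖ ≤ 2) (hR : R = ⌊2 * L⌋₊) (a : Fin d) : |latInt L x a| ≤ R := by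
  have h1 : |x a| ≤ 2 := (PiLp.norm_apply_le x a).trans hn
  have h2 : ((|latInt L x a| : ℤ) : ℝ) ≤ 2 * L := by
    rw [Int.cast_abs, latInt_cast hL hx, abs_mul, abs_of_pos hL]; nlinarith
  rw [Int.abs_eq_natAbs, hR]
  exact_mod_cast Nat.le_floor (by rwa [Nat.cast_natAbs])

/-- Lattice pairs in the centred ball of radius `2` with `x·y` and `r·x` both small. -/
def latNearOrth (d : ℕ) (L K : ℝ) (r : EuclideanSpace ℝ (Fin d)) :
    Set (EuclideanSpace ℝ (Fin d) × EuclideanSpace ℝ (Fin d)) :=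
  {p | p.1 ∈ ZLat d L ∧ p.2 ∈ ZLat d L ∧ ‖p.1‖ ≤ 2 ∧ ‖p.2‖ ≤ 2 ∧
    |⟪p.1, p.2⟫| ≤ 4 * K ∧ |⟪r, p.1⟫| ≤ 2 * K}

theorem ncard_latNearOrth_le {d R h : ℕ} {L K : ℝ} (hL : 0 < L) (hR : R = ⌊2 * L⌋₊)
    (hh : L ^ 2 * K ≤ h) {r : EuclideanSpace ℝ (Fin d)} (hr : r ∈ ZLat d L)
    (hfin : (nearOrth R h (latInt L r)).Finite) :
    (latNearOrth d L K r).Finite ∧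
      (latNearOrth d L K r).ncard ≤ (nearOrth R h (latInt L r)).ncard := by
  have hbound : ∀ {x y : EuclideanSpace ℝ (Fin d)} {c : ℕ}, x ∈ ZLat d L → y ∈ ZLat d L →
      |⟪x, y⟫| ≤ c * K → |∑ a, latInt L x a * latInt L y a| ≤ c * h := by
    intro x y c hx hy hxy
    have : ((|∑ a, latInt L x a * latInt L y a| : ℤ) : ℝ) ≤ c * h := by
      rw [Int.cast_abs, sum_latInt hL hx hy, abs_mul, abs_of_nonneg (sq_nonneg L)]
      calc L ^ 2 * |⟪x, y⟫| ≤ L ^ 2 * (c * K) := by gcongr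
        _ = c * (L ^ 2 * K) := by ring
        _ ≤ c * h := by gcongr
    exact_mod_cast this
  have hm : Set.MapsTo (fun p : EuclideanSpace ℝ (Fin d) × EuclideanSpace ℝ (Fin d) =>
      (latInt L p.1, latInt L p.2)) (latNearOrth d L K r) (nearOrth R h (latInt L r)) := by
    rintro ⟨x, y⟩ ⟨h1, h2, h3, h4, h5, h6⟩
    exact ⟨abs_latInt_le hL h1 h3 hR, abs_latInt_le hL h2 h4 hR,
      by exact_mod_cast hbound (c := 4) h1 h2 (by exact_mod_cast h5),
      by exact_mod_cast hbound (c := 2) hr h1 (by exact_mod_cast h6)⟩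
  have hi : Set.InjOn (fun p : EuclideanSpace ℝ (Fin d) × EuclideanSpace ℝ (Fin d) =>
      (latInt L p.1, latInt L p.2)) (latNearOrth d L K r) := by
    rintro ⟨x, y⟩ ⟨h1, h2, -⟩ ⟨x', y'⟩ ⟨h1', h2', -⟩ he
    simp only [Prod.mk.injEq] at he ⊢
    exact ⟨latInt_injOn hL h1 h1' he.1, latInt_injOn hL h2 h2' he.2⟩
  exact ⟨Set.Finite.of_injOn hm hi hfin,
    Set.ncard_le_ncard_of_injOn _ (fun z hz => hm hz) hi hfin⟩

theorem norm_sub_le_two {E : Type*} [SeminormedAddCommGroup E] {x x' c : E}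
    (h : ‖x - c‖ ≤ 1) (h' : ‖x' - c‖ ≤ 1) : ‖x - x'‖ ≤ 2 := by
  have := norm_sub_le (x - c) (x' - c)
  rw [sub_sub_sub_cancel_right] at this
  linarith

theorem abs_sub_le_two_mul {a b c K : ℝ} (h : |a - c| ≤ K) (h' : |b - c| ≤ K) :
    |a - b| ≤ 2 * K := by
  rw [abs_le] at *; constructor <;> linarith

/-- Taking differences in one variable and then in the other removes the centres `x0`, `y0` and
the levels `α`, `β`. -/
theorem ncard_le_ncard_latNearOrth {d : ℕ} {L K α : ℝ} {r x0 y0 : EuclideanSpace ℝ (Fin d)}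
    (hfin : (latNearOrth d L K r).Finite)
    {S : Set (EuclideanSpace ℝ (Fin d) × EuclideanSpace ℝ (Fin d))}
    (hS : ∀ p ∈ S, p.1 ∈ ZLat d L ∧ p.2 ∈ ZLat d L ∧ ‖p.1 - x0‖ ≤ 1 ∧ ‖p.2 - y0‖ ≤ 1 ∧
      |⟪p.1, p.2⟫ - α| ≤ K)
    (hr : ∀ p ∈ S, ∀ p' ∈ S, p.2 = p'.2 → |⟪r, p.1 - p'.1⟫| ≤ 2 * K) :
    S.ncard ≤ (latNearOrth d L K r).ncard := by
  let T : Set (EuclideanSpace ℝ (Fin d) × EuclideanSpace ℝ (Fin d)) :=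
    {p | p.1 ∈ ZLat d L ∧ p.2 ∈ ZLat d L ∧ ‖p.1 - y0‖ ≤ 1 ∧ ‖p.2‖ ≤ 2 ∧
      |⟪p.2, p.1⟫| ≤ 2 * K ∧ |⟪r, p.2⟫| ≤ 2 * K}
  have hT := ncard_le_of_fiber_sub (S := T) (T := latNearOrth d L K r) (fun p => p.2)
    (fun p => p.1) (fun _ _ _ _ h1 h2 => Prod.ext h2 h1) hfin ?_
  · refine (ncard_le_of_fiber_sub (S := S) (T := T) (fun p => p.2)
      (fun p => p.1) (fun _ _ _ _ h1 h2 => Prod.ext h2 h1) hT.1 ?_).2.trans hT.2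
    intro p hp p' hp' he
    obtain ⟨h1, h2, h3, h4, h5⟩ := hS p hp
    obtain ⟨h1', h2', h3', h4', h5'⟩ := hS p' hp'
    refine ⟨h2, sub_mem_ZLat h1 h1', h4, norm_sub_le_two h3 h3', ?_, hr p hp p' hp' he⟩
    simp only at he ⊢
    rw [inner_sub_left]
    rw [← he] at h5'
    exact abs_sub_le_two_mul h5 h5'
  · rintro ⟨y, x⟩ ⟨h1, h2, h3, h4, h5, h6⟩ ⟨y', x'⟩ ⟨h1', h2', h3', h4', h5', h6'⟩ he
    simp only at *
    subst he
    refine ⟨h2, sub_mem_ZLat h1 h1', h4, norm_sub_le_two h3 h3', ?_, h6⟩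
    simp only
    rw [inner_sub_right, show 4 * K = 2 * (2 * K) by ring]
    exact abs_sub_le_two_mul (c := 0) (by simpa using h5) (by simpa using h5')

theorem count1_le {d : ℕ} {L δ γ α β : ℝ} {r x0 y0 : EuclideanSpace ℝ (Fin d)}
    {ξ : EuclideanSpace ℝ (Fin d) → EuclideanSpace ℝ (Fin d) → EuclideanSpace ℝ (Fin d)}
    (hξ : (∀ x y, ξ x y = x) ∨ (∀ x y, ξ x y = y) ∨ (∀ x y, ξ x y = x + y))
    (hfin : (latNearOrth d L (δ⁻¹ * L ^ (-(2 * γ))) r).Finite) :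
    count1 d L δ γ α β r x0 y0 ξ ≤ (latNearOrth d L (δ⁻¹ * L ^ (-(2 * γ))) r).ncard := by
  rw [count1]
  rcases hξ with hξ | hξ | hξ
  · refine ncard_le_ncard_latNearOrth hfin (x0 := x0) (y0 := y0) (α := α)
      (fun p hp => ⟨hp.1, hp.2.1, hp.2.2.1, hp.2.2.2.1, hp.2.2.2.2.1⟩) ?_
    rintro p ⟨-, -, -, -, -, h⟩ p' ⟨-, -, -, -, -, h'⟩ -
    rw [hξ] at h h'
    rw [inner_sub_right]
    exact abs_sub_le_two_mul h h'
  · rw [← Set.ncard_image_of_injective _ Prod.swap_injective]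
    refine ncard_le_ncard_latNearOrth hfin (x0 := y0) (y0 := x0) (α := α) ?_ ?_
    · rintro _ ⟨p, hp, rfl⟩
      refine ⟨hp.2.1, hp.1, hp.2.2.2.1, hp.2.2.1, ?_⟩
      rw [real_inner_comm]
      exact hp.2.2.2.2.1
    · rintro _ ⟨p, ⟨-, -, -, -, -, h⟩, rfl⟩ _ ⟨p', ⟨-, -, -, -, -, h'⟩, rfl⟩ -
      rw [hξ] at h h'
      rw [inner_sub_right]
      exact abs_sub_le_two_mul h h'
  · refine ncard_le_ncard_latNearOrth hfin (x0 := x0) (y0 := y0) (α := α)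
      (fun p hp => ⟨hp.1, hp.2.1, hp.2.2.1, hp.2.2.2.1, hp.2.2.2.2.1⟩) ?_
    rintro p ⟨-, -, -, -, -, h⟩ p' ⟨-, -, -, -, -, h'⟩ he
    rw [hξ, inner_add_right] at h h'
    rw [inner_sub_right]
    rw [← he] at h'
    have := abs_sub_le_two_mul h h'
    rwa [add_sub_add_right_eq_sub] at this

/-- The integer count in terms of real parameters, up to logarithms. -/
theorem nearOrth_real_bound {d R h : ℕ} (hd : 3 ≤ d) {L H : ℝ} (hL : 1 ≤ L) (hH : 1 ≤ H)
    (hR : R = ⌊2 * L⌋₊) (hh : h = ⌈H⌉₊) {k : Fin d → ℤ} (hk : k ≠ 0) :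
    (nearOrth R h k).Finite ∧ ((nearOrth R h k).ncard : ℝ) ≤
      (5 * L) ^ (2 * d - 5) * (17 * H * (33 * H) * (45 * (8 * L * (1 + Real.log (8 * L))) ^ 2)) := by
  obtain ⟨i, hi⟩ := Function.ne_iff.1 hk
  have hcard : 1 < (Finset.univ.erase i).card := by
    rw [Finset.card_erase_of_mem (Finset.mem_univ i), Finset.card_univ, Fintype.card_fin]; omega
  obtain ⟨j, hj, l, hl, hjl⟩ := Finset.one_lt_card.1 hcard
  obtain ⟨hf, hc⟩ := ncard_nearOrth_le R h (k := k) hi (Finset.ne_of_mem_erase hj)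
    (Finset.ne_of_mem_erase hl) hjl
  refine ⟨hf, ?_⟩
  have hR2 : (R : ℝ) ≤ 2 * L := by rw [hR]; exact Nat.floor_le (by linarith)
  have hR1 : 1 ≤ R := by rw [hR]; exact Nat.le_floor (by push_cast; linarith)
  have hh2 : (h : ℝ) ≤ 2 * H := by
    rw [hh]; linarith [(Nat.ceil_lt_add_one (by linarith : 0 ≤ H)).le]
  have hq := (ncard_quadNearZeros_le (2 * R) (8 * h)).2
  have hz := ncard_quadZeros_le (X := 2 * (2 * R)) (by omega)
  have hX : ((2 * (2 * R) : ℕ) : ℝ) ≤ 8 * L := by push_cast; linarith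
  have hX1 : (1 : ℝ) ≤ ((2 * (2 * R) : ℕ) : ℝ) := by exact_mod_cast (by omega : 1 ≤ 2 * (2 * R))
  have hlog : 0 ≤ Real.log ((2 * (2 * R) : ℕ) : ℝ) := Real.log_nonneg hX1
  have hz' : ((quadZeros (2 * (2 * R))).ncard : ℝ) ≤
      45 * (8 * L * (1 + Real.log (8 * L))) ^ 2 := by
    refine hz.trans ?_
    gcongr
  have hq' : ((quadNearZeros (2 * R) (8 * h)).ncard : ℝ) ≤
      33 * H * (45 * (8 * L * (1 + Real.log (8 * L))) ^ 2) := by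
    calc ((quadNearZeros (2 * R) (8 * h)).ncard : ℝ)
        ≤ ((2 * (8 * h) + 1) * (quadZeros (2 * (2 * R))).ncard : ℕ) := by exact_mod_cast hq
      _ = (2 * (8 * h) + 1) * ((quadZeros (2 * (2 * R))).ncard : ℝ) := by push_cast; ring
      _ ≤ _ := by gcongr; linarith
  have hR5 : (2 * R + 1 : ℝ) ≤ 5 * L := by linarith
  calc ((nearOrth R h k).ncard : ℝ)
      ≤ ((2 * R + 1) ^ (d - 3) * ((2 * R + 1) ^ (d - 2) *
        ((8 * h + 1) * (quadNearZeros (2 * R) (8 * h)).ncard)) : ℕ) := by exact_mod_cast hc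
    _ = (2 * R + 1 : ℝ) ^ (2 * d - 5) *
        ((8 * h + 1) * ((quadNearZeros (2 * R) (8 * h)).ncard : ℝ)) := by
        rw [show 2 * d - 5 = (d - 3) + (d - 2) by omega, pow_add]; push_cast; ring
    _ ≤ (5 * L) ^ (2 * d - 5) *
        (17 * H * (33 * H * (45 * (8 * L * (1 + Real.log (8 * L))) ^ 2))) := by
        gcongr; linarith
    _ = _ := by ring

theorem sq_one_add_log_le {L : ℝ} (hL : 1 ≤ L) :
    (1 + Real.log (8 * L)) ^ 2 ≤ 784 * L ^ (1 / 10 : ℝ) := by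
  have h1 : Real.log L ≤ L ^ (1 / 20 : ℝ) / (1 / 20) :=
    Real.log_le_rpow_div (by linarith) (by norm_num)
  have h2 : (1 : ℝ) ≤ L ^ (1 / 20 : ℝ) := Real.one_le_rpow hL (by norm_num)
  have h8 : Real.log 8 ≤ 7 := by
    have := Real.log_le_sub_one_of_pos (show (0 : ℝ) < 8 by norm_num); linarith
  have h3 : 0 ≤ Real.log L := Real.log_nonneg hL
  have h80 : 0 ≤ Real.log 8 := Real.log_nonneg (by norm_num)
  rw [Real.log_mul (by norm_num) (by linarith)]
  calc (1 + (Real.log 8 + Real.log L)) ^ 2 ≤ (28 * L ^ (1 / 20 : ℝ)) ^ 2 := by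
        gcongr; linarith
    _ = 784 * L ^ (1 / 10 : ℝ) := by
        rw [mul_pow, ← Real.rpow_natCast (L ^ (1 / 20 : ℝ)), ← Real.rpow_mul (by linarith)]
        norm_num

theorem statement3 (d : ℕ) (hd : 3 ≤ d) (γ : ℝ) (hγ : 0 < γ) (hγ' : γ < 1) :
    ∃ η₀ : ℝ, 0 < η₀ ∧ ∀ η : ℝ, 0 < η → η ≤ η₀ →
    ∃ C : ℝ, 2 ≤ C ∧
    ∀ L δ : ℝ, C ≤ L → 0 < δ → δ < 1 → δ⁻¹ ≤ L ^ (η ^ 2) →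
    ∀ (α β : ℝ) (r : EuclideanSpace ℝ (Fin d)), r ∈ ZLat d L →
    ∀ P : ℝ,
      ((P = 0 ∧ r = 0) ∨ (L⁻¹ ≤ P ∧ P < 1 ∧ P ≤ ‖r‖ ∧ ‖r‖ ≤ 2 * P) ∨ (P = 1 ∧ 1 ≤ ‖r‖)) →
    ∀ (x0 y0 : EuclideanSpace ℝ (Fin d))
      (ξ : EuclideanSpace ℝ (Fin d) → EuclideanSpace ℝ (Fin d) → EuclideanSpace ℝ (Fin d)),
      ((∀ x y, ξ x y = x) ∨ (∀ x y, ξ x y = y) ∨ (∀ x y, ξ x y = x + y)) →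
      4 / 5 - 10 * η < γ → P ≠ 0 →
      (count1 d L δ γ α β r x0 y0 ξ : ℝ) ≤
        C * δ⁻¹ ^ 2 * L ^ (2 * ((d : ℝ) - γ) - (1 - γ) - 20 * η) := by
  refine ⟨1 / 200, by norm_num, fun η hη hη₀ => ?_⟩
  refine ⟨5 ^ (2 * d) * (17 * 33 * 45 * 64 * 784), ?_, ?_⟩
  · have : (1 : ℝ) ≤ 5 ^ (2 * d) := one_le_pow₀ (by norm_num)
    linarith
  intro L δ hCL hδ hδ1 _ α β r hr P hP x0 y0 ξ hξ hγ4 hP0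
  have hL : 1 ≤ L := by
    have : (1 : ℝ) ≤ 5 ^ (2 * d) := one_le_pow₀ (by norm_num)
    linarith
  have hL0 : 0 < L := by linarith
  have hrn : 0 < ‖r‖ := by
    rcases hP with ⟨h, -⟩ | ⟨h1, -, h2, -⟩ | ⟨-, h⟩
    · exact absurd h hP0
    · exact (inv_pos.2 hL0).trans_le (h1.trans h2)
    · linarith
  have hk : latInt L r ≠ 0 := by
    intro h
    refine norm_pos_iff.1 hrn ?_
    ext a
    have := latInt_cast hL0 hr a
    rw [h] at this
    simpa [hL0.ne'] using this.symm
  set K := δ⁻¹ * L ^ (-(2 * γ)) with hK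
  have hLK : L ^ 2 * K = δ⁻¹ * L ^ (2 - 2 * γ) := by
    rw [hK, sub_eq_add_neg, Real.rpow_add hL0, Real.rpow_two]; ring
  have hH : 1 ≤ L ^ 2 * K := by
    rw [hLK]
    exact one_le_mul_of_one_le_of_one_le (one_le_inv₀ hδ |>.2 hδ1.le)
      (Real.one_le_rpow hL (by linarith))
  obtain ⟨hf, hc⟩ := nearOrth_real_bound hd hL hH rfl rfl hk
  obtain ⟨hf', hc'⟩ := ncard_latNearOrth_le hL0 rfl (Nat.le_ceil (L ^ 2 * K)) hr hf
  have hcount := (count1_le (α := α) (β := β) (x0 := x0) (y0 := y0) hξ hf').trans hc'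
  refine (Nat.cast_le.2 hcount).trans (hc.trans ?_)
  have hpow : L ^ (2 * d - 5) * L ^ 2 * (L ^ (2 - 2 * γ)) ^ 2 * L ^ (1 / 10 : ℝ) ≤
      L ^ (2 * ((d : ℝ) - γ) - (1 - γ) - 20 * η) := by
    have hd5 : ((2 * d - 5 : ℕ) : ℝ) = 2 * d - 5 := by
      rw [Nat.cast_sub (by omega)]; push_cast; ring
    rw [← Real.rpow_natCast L, ← Real.rpow_natCast L, ← Real.rpow_natCast (L ^ (2 - 2 * γ)),
      ← Real.rpow_mul hL0.le, ← Real.rpow_add hL0, ← Real.rpow_add hL0, ← Real.rpow_add hL0, hd5]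
    refine Real.rpow_le_rpow_of_exponent_le hL ?_
    push_cast
    linarith
  have h5 : (5 : ℝ) ^ (2 * d - 5) ≤ 5 ^ (2 * d) := pow_le_pow_right₀ (by norm_num) (by omega)
  rw [hLK, mul_pow]
  calc _ = 5 ^ (2 * d - 5) * (17 * 33 * 45 * 64) * δ⁻¹ ^ 2 *
        (L ^ (2 * d - 5) * L ^ 2 * (L ^ (2 - 2 * γ)) ^ 2 * (1 + Real.log (8 * L)) ^ 2) := by ring
    _ ≤ 5 ^ (2 * d) * (17 * 33 * 45 * 64) * δ⁻¹ ^ 2 *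
        (L ^ (2 * d - 5) * L ^ 2 * (L ^ (2 - 2 * γ)) ^ 2 * (784 * L ^ (1 / 10 : ℝ))) := by
        gcongr
        exact sq_one_add_log_le hL
    _ = 5 ^ (2 * d) * (17 * 33 * 45 * 64 * 784) * δ⁻¹ ^ 2 *
        (L ^ (2 * d - 5) * L ^ 2 * (L ^ (2 - 2 * γ)) ^ 2 * L ^ (1 / 10 : ℝ)) := by ring
    _ ≤ _ := by gcongr
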